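/- arXiv:2506.07409 — 2 statements merged into one kernel-verified Lean document; each statement's English description precedes it below -/
import Mathlib

section
/- Let F ∈ H ⊗ H be a 2-cocycle of a finite-dimensional Hopf algebra H with F_n defined inductively as usual. Then for all m, n ≥ 0: F_{m+n} = (F_m ⊗ F_n) · (Δ^m ⊗ Δⁿ)(F). -/
/-!
STATEMENT 6 (Lemma `lem:trick-3`(ii)):
For a 2-cocycle F of a finite-dimensional Hopf algebra H, with higher twists F_n
(F₁ = 1, F_{n+1} = (1 ⊗ F_n)·(id ⊗ Δⁿ)(F)), for all m, n ≥ 1: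
  F_{m+n} = (F_m ⊗ F_n) · (Δ^m ⊗ Δⁿ)(F).
-/

open TensorProduct

structure AlgBundle (k : Type) [CommRing k] where
  carrier : Type
  ring : Ring carrier
  alg : @Algebra k carrier _ ring.toSemiring

section
variable (k H : Type) [Field k] [Ring H] [HopfAlgebra k H]

noncomputable def tpowB : ℕ → AlgBundle k
  | 0 => ⟨H, inferInstance, inferInstance⟩
  | n + 1 =>
      letI := (tpowB n).ring
      letI := (tpowB n).alg
      ⟨TensorProduct k H (tpowB n).carrier, inferInstance, inferInstance⟩

/-- `Tpow k H n` is the (n+1)-fold tensor power `H ⊗ (H ⊗ (⋯ ⊗ H))`. -/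
noncomputable def Tpow (n : ℕ) : Type := (tpowB k H n).carrier

noncomputable instance instTpowRing (n : ℕ) : Ring (Tpow k H n) := (tpowB k H n).ring
noncomputable instance instTpowAlgebra (n : ℕ) : Algebra k (Tpow k H n) := (tpowB k H n).alg

/-- The iterated comultiplication `Δ^{n+1} : H → H^{⊗(n+1)}`. -/
noncomputable def comulIter : ∀ n : ℕ, H →ₗ[k] Tpow k H n
  | 0 => LinearMap.id
  | n + 1 =>
      show H →ₗ[k] TensorProduct k H (Tpow k H n) from
        (TensorProduct.map LinearMap.id (comulIter n)) ∘ₗ Coalgebra.comul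

/-- The higher twists of `F`:  `Fseq F n = F_{n+1}`. -/
noncomputable def Fseq (F : H ⊗[k] H) : ∀ n : ℕ, Tpow k H n
  | 0 => 1
  | n + 1 =>
      show TensorProduct k H (Tpow k H n) from
        ((1 : H) ⊗ₜ[k] Fseq F n) * (TensorProduct.map LinearMap.id (comulIter k H n) F)

/-- Cast between tensor powers of equal length. -/
noncomputable def tcast {a b : ℕ} (h : a = b) : Tpow k H a ≃ₗ[k] Tpow k H b :=
  h ▸ LinearEquiv.refl k (Tpow k H a)

/-- The canonical identification `H^{⊗(a+1)} ⊗ H^{⊗(b+1)} ≅ H^{⊗(a+b+2)}`. -/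
noncomputable def concEquiv : ∀ a b : ℕ, (Tpow k H a ⊗[k] Tpow k H b) ≃ₗ[k] Tpow k H (a + 1 + b)
  | 0, b =>
      (show (Tpow k H 0 ⊗[k] Tpow k H b) ≃ₗ[k] Tpow k H (b + 1) from
        LinearEquiv.refl k (Tpow k H 0 ⊗[k] Tpow k H b)).trans (tcast k H (by omega))
  | a + 1, b =>
      (show (Tpow k H (a+1) ⊗[k] Tpow k H b) ≃ₗ[k] H ⊗[k] (Tpow k H a ⊗[k] Tpow k H b) from
        TensorProduct.assoc k H (Tpow k H a) (Tpow k H b)).trans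
      ((TensorProduct.congr (LinearEquiv.refl k H) (concEquiv a b)).trans
        ((show (TensorProduct k H (Tpow k H (a + 1 + b))) ≃ₗ[k] Tpow k H (a + 1 + b + 1) from
            LinearEquiv.refl k _).trans (tcast k H (by omega))))

end

section
variable (k H : Type) [Field k] [Ring H] [HopfAlgebra k H]

noncomputable def tcastA {a b : ℕ} (h : a = b) : Tpow k H a →ₐ[k] Tpow k H b :=
  h ▸ AlgHom.id k (Tpow k H a)

theorem tcastA_apply {a b : ℕ} (h : a = b) (x) : tcastA k H h x = tcast k H h x := by
  subst h; rfl

theorem tcast_Fseq (F : H ⊗[k] H) {a b : ℕ} (h : a = b) :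
    tcast k H h (Fseq k H F a) = Fseq k H F b := by
  subst h; rfl

theorem tcast_comulIter {a b : ℕ} (h : a = b) (x : H) :
    tcast k H h (comulIter k H a x) = comulIter k H b x := by
  subst h; rfl

noncomputable def comulIterA : ∀ n : ℕ, H →ₐ[k] Tpow k H n
  | 0 => AlgHom.id k H
  | n + 1 =>
      show H →ₐ[k] TensorProduct k H (Tpow k H n) from
        (Algebra.TensorProduct.map (AlgHom.id k H) (comulIterA n)).comp (Bialgebra.comulAlgHom k H)

theorem comulIterA_toLin (n : ℕ) : (comulIterA k H n).toLinearMap = comulIter k H n := by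
  induction n with
  | zero => rfl
  | succ n ih =>
    have : comulIter k H (n+1) =
      (TensorProduct.map LinearMap.id (comulIter k H n)) ∘ₗ Coalgebra.comul := rfl
    rw [this, ← ih]
    rfl

theorem concEquiv_zero (b : ℕ) (x : H ⊗[k] Tpow k H b) :
    concEquiv k H 0 b x = tcast k H (a := b + 1) (by omega) x := rfl

theorem concEquiv_succ (a b : ℕ) (x : (H ⊗[k] Tpow k H a) ⊗[k] Tpow k H b) :
    concEquiv k H (a+1) b x = tcast k H (a := a + 1 + b + 1) (by omega)
      (TensorProduct.map (LinearMap.id : H →ₗ[k] H) (concEquiv k H a b).toLinearMap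
        (TensorProduct.assoc k H (Tpow k H a) (Tpow k H b) x)) := rfl

noncomputable def concA : ∀ a b : ℕ, (Tpow k H a ⊗[k] Tpow k H b) →ₐ[k] Tpow k H (a + 1 + b)
  | 0, b =>
      (tcastA k H (a := b + 1) (by omega)).comp
      (show (Tpow k H 0 ⊗[k] Tpow k H b) →ₐ[k] Tpow k H (b + 1) from
        AlgHom.id k (Tpow k H 0 ⊗[k] Tpow k H b))
  | a + 1, b =>
      (tcastA k H (a := a + 1 + b + 1) (by omega)).comp
      (show ((H ⊗[k] Tpow k H a) ⊗[k] Tpow k H b) →ₐ[k] H ⊗[k] Tpow k H (a + 1 + b) from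
      (Algebra.TensorProduct.map (AlgHom.id k H) (concA a b)).comp
        (Algebra.TensorProduct.assoc k k k H (Tpow k H a) (Tpow k H b)).toAlgHom)

theorem concA_toLin (a b : ℕ) :
    (concA k H a b).toLinearMap = (concEquiv k H a b).toLinearMap := by
  induction a with
  | zero =>
    ext1
    apply LinearMap.ext; intro x
    apply LinearMap.ext; intro y
    exact tcastA_apply k H _ _
  | succ a ih =>
    apply LinearMap.ext; intro x
    refine Eq.trans ?_ (concEquiv_succ k H a b x).symm
    rw [← ih]
    exact tcastA_apply k H _ _

theorem comulIter_conc (a b : ℕ) (x : H) :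
    concEquiv k H a b (TensorProduct.map (comulIter k H a) (comulIter k H b)
      (Coalgebra.comul (R := k) x)) = comulIter k H (a + 1 + b) x := by
  induction a generalizing x with
  | zero =>
    refine (concEquiv_zero k H b _).trans ?_
    exact tcast_comulIter k H (a := b + 1) _ x
  | succ a ih =>
    refine (concEquiv_succ k H a b _).trans ?_
    rw [← tcast_comulIter k H (a := a + 1 + b + 1) (by omega)]
    congr 1
    have h1 : comulIter k H (a + 1 + b + 1) x =
      (TensorProduct.map LinearMap.id (comulIter k H (a + 1 + b))) (Coalgebra.comul x) := rfl
    have h2 : comulIter k H (a + 1) =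
      (TensorProduct.map LinearMap.id (comulIter k H a)) ∘ₗ Coalgebra.comul := rfl
    have ih' : comulIter k H (a + 1 + b) = (concEquiv k H a b).toLinearMap ∘ₗ
      (TensorProduct.map (comulIter k H a) (comulIter k H b)) ∘ₗ Coalgebra.comul :=
      LinearMap.ext fun x => (ih x).symm
    refine Eq.trans ?_ h1.symm
    rw [ih']
    have key : ∀ z : H ⊗[k] H,
      (TensorProduct.map (LinearMap.id : H →ₗ[k] H) (concEquiv k H a b).toLinearMap
        (TensorProduct.assoc k H (Tpow k H a) (Tpow k H b)
          (TensorProduct.map ((TensorProduct.map LinearMap.id (comulIter k H a)) ∘ₗ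
            Coalgebra.comul) (comulIter k H b) z))) =
      TensorProduct.map (LinearMap.id : H →ₗ[k] H) ((concEquiv k H a b).toLinearMap ∘ₗ
        (TensorProduct.map (comulIter k H a) (comulIter k H b)))
        (TensorProduct.assoc k H H H (TensorProduct.map Coalgebra.comul LinearMap.id z)) := by
      intro z
      induction z with
      | zero => simp
      | add u v hu hv => simp only [map_add, hu, hv]
      | tmul u v =>
        simp only [TensorProduct.map_tmul, LinearMap.comp_apply, LinearMap.id_apply]
        generalize (Coalgebra.comul (R := k) u) = w
        induction w with
        | zero => simp
        | add u v hu hv => simp only [map_add, TensorProduct.add_tmul, hu, hv]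
        | tmul u v => simp
    refine (key _).trans ?_
    have := Coalgebra.coassoc_apply (R := k) x
    erw [this]
    generalize (Coalgebra.comul (R := k) x) = w
    induction w with
    | zero => simp
    | add u v hu hv => simp only [map_add, hu, hv]
    | tmul u v => simp

theorem twist_step {A B C : Type} [Ring A] [Algebra k A] [Ring B] [Algebra k B]
    [Ring C] [Algebra k C] (α : H →ₐ[k] A) (β : H →ₐ[k] B) (c : A ⊗[k] B →ₐ[k] C)
    (x : A) (y : B) (F : H ⊗[k] H)
    (hcoc : ((1 : H) ⊗ₜ[k] F) *
        (TensorProduct.map LinearMap.id (Coalgebra.comul (R := k)) F) =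
      (TensorProduct.assoc k H H H)
        ((F ⊗ₜ[k] (1 : H)) *
          (TensorProduct.map (Coalgebra.comul (R := k)) LinearMap.id F))) :
    ((1 : H) ⊗ₜ[k] c ((x ⊗ₜ[k] y) * TensorProduct.map α.toLinearMap β.toLinearMap F)) *
      TensorProduct.map LinearMap.id (c.toLinearMap ∘ₗ
        TensorProduct.map α.toLinearMap β.toLinearMap ∘ₗ Coalgebra.comul) F =
    TensorProduct.map LinearMap.id c.toLinearMap (TensorProduct.assoc k H A B
      (((((1 : H) ⊗ₜ[k] x) * TensorProduct.map LinearMap.id α.toLinearMap F) ⊗ₜ[k] y) *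
        TensorProduct.map (TensorProduct.map LinearMap.id α.toLinearMap ∘ₗ Coalgebra.comul)
          β.toLinearMap F)) := by
  let Φ : H ⊗[k] (H ⊗[k] H) →ₐ[k] H ⊗[k] (A ⊗[k] B) :=
    Algebra.TensorProduct.map (AlgHom.id k H) (Algebra.TensorProduct.map α β)
  let M : H ⊗[k] (A ⊗[k] B) →ₐ[k] H ⊗[k] C := Algebra.TensorProduct.map (AlgHom.id k H) c
  let S := Algebra.TensorProduct.assoc k k k H A B
  let S' := Algebra.TensorProduct.assoc k k k H H H
  let Ψ : (H ⊗[k] H) ⊗[k] H →ₐ[k] (H ⊗[k] A) ⊗[k] B :=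
    Algebra.TensorProduct.map (Algebra.TensorProduct.map (AlgHom.id k H) α) β
  have hS : ∀ z, Φ (S' z) = S (Ψ z) := by
    intro z
    have : (Φ.comp S'.toAlgHom) = S.toAlgHom.comp Ψ := by
      ext <;> simp [Φ, S', S, Ψ, Algebra.TensorProduct.one_def]
    exact DFunLike.congr_fun this z
  have e1 : TensorProduct.map (LinearMap.id : H →ₗ[k] H) (c.toLinearMap ∘ₗ
        TensorProduct.map α.toLinearMap β.toLinearMap ∘ₗ Coalgebra.comul) F =
      M (Φ (TensorProduct.map LinearMap.id (Coalgebra.comul (R := k)) F)) := by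
    clear hcoc
    induction F with
    | zero => simp
    | add u v hu hv => simp only [map_add, hu, hv]
    | tmul u v => rfl
  have e2 : ((1 : H) ⊗ₜ[k] c ((x ⊗ₜ[k] y) * TensorProduct.map α.toLinearMap β.toLinearMap F)) =
      M (((1 : H) ⊗ₜ[k] (x ⊗ₜ[k] y)) * Φ ((1 : H) ⊗ₜ[k] F)) := by
    simp only [M, Φ, Algebra.TensorProduct.map_tmul, Algebra.TensorProduct.tmul_mul_tmul, map_one,
      mul_one]
    rfl
  have e3 : ((((1 : H) ⊗ₜ[k] x) * TensorProduct.map LinearMap.id α.toLinearMap F) ⊗ₜ[k] y) =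
      (((1 : H) ⊗ₜ[k] x) ⊗ₜ[k] y) * Ψ (F ⊗ₜ[k] (1 : H)) := by
    simp only [Ψ, Algebra.TensorProduct.map_tmul, Algebra.TensorProduct.tmul_mul_tmul, map_one,
      mul_one]
    rfl
  have e4 : TensorProduct.map (TensorProduct.map LinearMap.id α.toLinearMap ∘ₗ Coalgebra.comul)
          β.toLinearMap F = Ψ (TensorProduct.map (Coalgebra.comul (R := k)) LinearMap.id F) := by
    clear hcoc e1 e2 e3
    induction F with
    | zero => simp
    | add u v hu hv => simp only [map_add, hu, hv]
    | tmul u v => rfl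
  rw [e1, e2, e3, e4, ← map_mul, mul_assoc, mul_assoc, ← map_mul, ← map_mul, hcoc]
  change M (_ * Φ (S' _)) = M (S _)
  rw [hS, map_mul S]
  rfl

theorem twist_main (F : H ⊗[k] H)
    (hcoc : ((1 : H) ⊗ₜ[k] F) *
        (TensorProduct.map LinearMap.id (Coalgebra.comul (R := k)) F) =
      (TensorProduct.assoc k H H H)
        ((F ⊗ₜ[k] (1 : H)) *
          (TensorProduct.map (Coalgebra.comul (R := k)) LinearMap.id F))) (a b : ℕ) :
    Fseq k H F (a + 1 + b) = concEquiv k H a b ((Fseq k H F a ⊗ₜ[k] Fseq k H F b) *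
            (TensorProduct.map (comulIter k H a) (comulIter k H b) F)) := by
  induction a with
  | zero =>
    rw [← tcast_Fseq k H F (a := b + 1) (by omega)]
    exact (concEquiv_zero k H b _).symm
  | succ a ih =>
    rw [← tcast_Fseq k H F (a := a + 1 + b + 1) (by omega)]
    refine Eq.trans ?_ (concEquiv_succ k H a b _).symm
    congr 1
    have h1 : Fseq k H F (a + 1 + b + 1) = ((1 : H) ⊗ₜ[k] Fseq k H F (a + 1 + b)) *
      (TensorProduct.map LinearMap.id (comulIter k H (a + 1 + b)) F) := rfl
    have ih' : comulIter k H (a + 1 + b) = (concA k H a b).toLinearMap ∘ₗ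
      (TensorProduct.map (comulIterA k H a).toLinearMap (comulIterA k H b).toLinearMap) ∘ₗ
        Coalgebra.comul := by
      rw [concA_toLin, comulIterA_toLin, comulIterA_toLin]
      exact LinearMap.ext fun x => (comulIter_conc k H a b x).symm
    have h3 : ∀ z, concEquiv k H a b z = concA k H a b z := fun z =>
      (DFunLike.congr_fun (concA_toLin k H a b) z).symm
    refine h1.trans ?_
    rw [ih, ih', h3, ← comulIterA_toLin, ← comulIterA_toLin]
    refine (twist_step k H _ _ _ _ _ F hcoc).trans ?_
    rw [concA_toLin, comulIterA_toLin, comulIterA_toLin]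
    rfl

end

theorem statement6
    (k H : Type) [Field k] [Ring H] [HopfAlgebra k H] [FiniteDimensional k H]
    (F F' : H ⊗[k] H)
    (hinv₁ : F * F' = 1) (hinv₂ : F' * F = 1)
    (hcu₁ : (TensorProduct.lid k H)
      ((TensorProduct.map (Coalgebra.counit (R := k)) LinearMap.id) F) = 1)
    (hcu₂ : (TensorProduct.rid k H)
      ((TensorProduct.map LinearMap.id (Coalgebra.counit (R := k))) F) = 1)
    (hcoc : ((1 : H) ⊗ₜ[k] F) *
        (TensorProduct.map LinearMap.id (Coalgebra.comul (R := k)) F) =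
      (TensorProduct.assoc k H H H)
        ((F ⊗ₜ[k] (1 : H)) *
          (TensorProduct.map (Coalgebra.comul (R := k)) LinearMap.id F)))
    (m n : ℕ) (hm : 1 ≤ m) (hn : 1 ≤ n) :
    Fseq k H F (m + n - 1) =
      (tcast k H (by omega : (m - 1) + 1 + (n - 1) = m + n - 1))
        ((concEquiv k H (m - 1) (n - 1))
          ((Fseq k H F (m - 1) ⊗ₜ[k] Fseq k H F (n - 1)) *
            (TensorProduct.map (comulIter k H (m - 1)) (comulIter k H (n - 1)) F))) := by
  obtain ⟨a, rfl⟩ : ∃ a, m = a + 1 := ⟨m - 1, by omega⟩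
  obtain ⟨b, rfl⟩ : ∃ b, n = b + 1 := ⟨n - 1, by omega⟩
  refine Eq.trans ?_ (congrArg _ (twist_main k H F hcoc a b))
  exact (tcast_Fseq k H F _).symm
end

section
/- Let F be a 2-cocycle of a finite-dimensional Hopf algebra H, write F_n = f⁽¹⁾⊗⋯⊗f⁽ⁿ⁾ (summation over an index i suppressed), and u = f⁽¹⁾S(f⁽²⁾) from F₂ = F. Then for every n ≥ 1: 1 ⊗ u^{⊗n} = f⁽¹⁾ ⊗ ⨂_{ℓ=2}^{n+1} f⁽ℓ⁾ S(f⁽²ⁿ⁺³⁻ℓ⁾), where the tensor components on the right come from F_{2n+2}. -/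
/-!
STATEMENT 8 (Lemma `lem:trick-3`(iv), eq. (u-f-Sf-1)):
For a 2-cocycle F of a finite-dimensional Hopf algebra H with Drinfeld element
u = f⁽¹⁾S(f⁽²⁾), for every n ≥ 1:
  1 ⊗ u^{⊗n} = Σ f⁽¹⁾ ⊗ ⨂_{ℓ=2}^{n+1} f⁽ℓ⁾ S(f⁽²ⁿ⁺³⁻ℓ⁾),
where f⁽¹⁾, …, f⁽²ⁿ⁺¹⁾ are the tensor components (with suppressed summation) of the
higher twist whose components appear in the formula (F_{2n+1}, all of whose 2n+1
components occur on the right-hand side).  Components are encoded by an arbitrary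
finite-sum representation of F_{2n+1} = Fseq F 2n by pure tensors.
-/

open TensorProduct

section
variable (k H : Type) [Field k] [Ring H] [HopfAlgebra k H]

/-- The nested pure tensor `f 0 ⊗ f 1 ⊗ ⋯ ⊗ f n` of a tuple. -/
noncomputable def nest : ∀ n : ℕ, (Fin (n + 1) → H) → Tpow k H n
  | 0, f => f 0
  | n + 1, f =>
      show TensorProduct k H (Tpow k H n) from f 0 ⊗ₜ[k] nest n (fun i => f i.succ)

end

section helpers
variable (k H : Type) [Field k] [Ring H] [HopfAlgebra k H]

open Coalgebra

/-- The defining identification of `H ⊗ H^{⊗(n+1)}` with `H^{⊗(n+2)}`. -/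
noncomputable def consE (n : ℕ) : (H ⊗[k] Tpow k H n) ≃ₐ[k] Tpow k H (n + 1) :=
  show (H ⊗[k] Tpow k H n) ≃ₐ[k] (H ⊗[k] Tpow k H n) from AlgEquiv.refl

/-- Appending a tensor factor on the right. -/
noncomputable def snocE : ∀ n : ℕ, (Tpow k H n ⊗[k] H) ≃ₐ[k] Tpow k H (n + 1)
  | 0 => show (H ⊗[k] H) ≃ₐ[k] Tpow k H 1 from consE k H 0
  | n + 1 =>
    ((Algebra.TensorProduct.congr (consE k H n).symm AlgEquiv.refl).trans
      (Algebra.TensorProduct.assoc k k k H (Tpow k H n) H)).trans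
      ((Algebra.TensorProduct.congr AlgEquiv.refl (snocE n)).trans (consE k H (n + 1)))

lemma snocE_cons (n : ℕ) (h : H) (t : Tpow k H n) (c : H) :
    snocE k H (n + 1) (consE k H n (h ⊗ₜ t) ⊗ₜ c) =
      consE k H (n + 1) (h ⊗ₜ snocE k H n (t ⊗ₜ c)) := by
  simp [snocE]

/-- The iterated comultiplication as an algebra map. -/
noncomputable def cA : ∀ n : ℕ, H →ₐ[k] Tpow k H n
  | 0 => show H →ₐ[k] H from AlgHom.id k H
  | n + 1 => ((consE k H n).toAlgHom.comp
      (Algebra.TensorProduct.map (AlgHom.id k H) (cA n))).comp (Bialgebra.comulAlgHom k H)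

lemma cA_succ (n : ℕ) (x : H) : cA k H (n + 1) x =
    consE k H n (Algebra.TensorProduct.map (AlgHom.id k H) (cA k H n) (comul (R := k) x)) := rfl

lemma cA_eq (n : ℕ) : (cA k H n).toLinearMap = comulIter k H n := by
  induction n with
  | zero => rfl
  | succ n ih =>
    apply LinearMap.ext; intro x
    have : comulIter k H (n + 1) x =
      consE k H n (TensorProduct.map LinearMap.id (comulIter k H n) (comul (R := k) x)) := rfl
    rw [this, ← ih]; rfl

/-- `id ⊗ Δ^{m+1} ⊗ id`. -/
noncomputable def tA (m : ℕ) : (H ⊗[k] (H ⊗[k] H)) →ₐ[k] Tpow k H (m + 2) :=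
  (consE k H (m + 1)).toAlgHom.comp (Algebra.TensorProduct.map (AlgHom.id k H)
    ((snocE k H m).toAlgHom.comp (Algebra.TensorProduct.map (cA k H m) (AlgHom.id k H))))

lemma tA_tmul (m : ℕ) (a b d : H) : tA k H m (a ⊗ₜ (b ⊗ₜ d)) =
    consE k H (m + 1) (a ⊗ₜ snocE k H m (cA k H m b ⊗ₜ d)) := rfl

lemma tA_assoc (m : ℕ) (y : (H ⊗[k] H) ⊗[k] H) : tA k H m (TensorProduct.assoc k H H H y) =
    snocE k H (m + 1) (TensorProduct.map ((consE k H m).toLinearMap ∘ₗ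
      TensorProduct.map LinearMap.id (cA k H m).toLinearMap) LinearMap.id y) := by
  induction y with
  | zero => simp
  | add a b ha hb => simp only [map_add, ha, hb]
  | tmul z c =>
    induction z with
    | zero => simp
    | add a b ha hb => simp only [map_add, TensorProduct.add_tmul, ha, hb]
    | tmul a b =>
      rw [TensorProduct.assoc_tmul, tA_tmul, ← snocE_cons]; rfl

lemma map_comul_assoc (x : H) :
    TensorProduct.map LinearMap.id (comul (R := k)) (comul (R := k) x) =
      TensorProduct.assoc k H H H
        (TensorProduct.map (comul (R := k)) LinearMap.id (comul (R := k) x)) :=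
  (Coalgebra.coassoc_apply (R := k) x).symm

lemma cons_map_map (m : ℕ) (y : H ⊗[k] H) :
    snocE k H (m + 1) (TensorProduct.map ((consE k H m).toLinearMap ∘ₗ
      TensorProduct.map LinearMap.id (cA k H m).toLinearMap) LinearMap.id
        (TensorProduct.map (comul (R := k)) LinearMap.id y)) =
    snocE k H (m + 1) (TensorProduct.map (cA k H (m + 1)).toLinearMap LinearMap.id y) := by
  rw [← LinearMap.comp_apply, ← TensorProduct.map_comp]; rfl

lemma cA_snoc (n : ℕ) (x : H) : cA k H (n + 1) x =
    snocE k H n (TensorProduct.map (cA k H n).toLinearMap LinearMap.id (comul (R := k) x)) := by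
  induction n generalizing x with
  | zero => rfl
  | succ n ih =>
    rw [← cons_map_map, ← tA_assoc, ← map_comul_assoc, cA_succ]
    induction comul (R := k) x with
    | zero => simp
    | add a b ha hb => simp only [map_add, ha, hb]
    | tmul a b =>
      simp only [Algebra.TensorProduct.map_tmul, TensorProduct.map_tmul, ih]
      induction comul (R := k) b with
      | zero => simp
      | add a b ha hb => simp only [map_add, TensorProduct.tmul_add, ha, hb]
      | tmul b d => rfl

lemma map_cA (m : ℕ) (y : H ⊗[k] H) :
    consE k H (m + 1) (TensorProduct.map LinearMap.id (cA k H (m + 1)).toLinearMap y) =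
      tA k H m (TensorProduct.map LinearMap.id (comul (R := k)) y) := by
  induction y with
  | zero => simp
  | add a b ha hb => simp only [map_add, ha, hb]
  | tmul a b =>
    simp only [TensorProduct.map_tmul, AlgHom.toLinearMap_apply, cA_snoc]
    induction comul (R := k) b with
    | zero => simp
    | add a b ha hb => simp only [map_add, TensorProduct.tmul_add, ha, hb]
    | tmul b d => rfl

lemma Fseq_succ (F : H ⊗[k] H) (n : ℕ) : Fseq k H F (n + 1) =
    consE k H n (1 ⊗ₜ Fseq k H F n) *
      consE k H n (TensorProduct.map LinearMap.id (cA k H n).toLinearMap F) := by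
  rw [cA_eq]; rfl

/-- The element `F₃`. -/
noncomputable def F3 (F : H ⊗[k] H) : H ⊗[k] (H ⊗[k] H) :=
  ((1 : H) ⊗ₜ[k] F) * (TensorProduct.map LinearMap.id (Coalgebra.comul (R := k)) F)

lemma Fseq_add_two (F : H ⊗[k] H) (m : ℕ)
    (h : Fseq k H F (m + 1) = snocE k H m (Fseq k H F m ⊗ₜ 1) *
      snocE k H m (TensorProduct.map (cA k H m).toLinearMap LinearMap.id F)) :
    Fseq k H F (m + 2) = consE k H (m + 1) (1 ⊗ₜ snocE k H m (Fseq k H F m ⊗ₜ 1)) *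
      tA k H m (F3 k H F) := by
  rw [Fseq_succ k H F (m + 1), h, map_cA, F3, map_mul (tA k H m), ← mul_assoc]
  congr 1
  have : tA k H m (1 ⊗ₜ F) = consE k H (m + 1) (1 ⊗ₜ
    snocE k H m (TensorProduct.map (cA k H m).toLinearMap LinearMap.id F)) := rfl
  rw [this, ← map_mul (consE k H (m + 1)), Algebra.TensorProduct.tmul_mul_tmul, one_mul]

lemma Fseq_snoc (F : H ⊗[k] H)
    (hcoc : F3 k H F =
      (TensorProduct.assoc k H H H)
        ((F ⊗ₜ[k] (1 : H)) *
          (TensorProduct.map (Coalgebra.comul (R := k)) LinearMap.id F))) (m : ℕ) :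
    Fseq k H F (m + 1) = snocE k H m (Fseq k H F m ⊗ₜ 1) *
      snocE k H m (TensorProduct.map (cA k H m).toLinearMap LinearMap.id F) := by
  induction m with
  | zero => rw [Fseq_succ]; rfl
  | succ m ih =>
    have e : (TensorProduct.assoc k H H H)
        ((F ⊗ₜ[k] (1 : H)) *
          (TensorProduct.map (Coalgebra.comul (R := k)) LinearMap.id F)) =
        (TensorProduct.assoc k H H H) (F ⊗ₜ[k] (1 : H)) *
        (TensorProduct.assoc k H H H)
          (TensorProduct.map (Coalgebra.comul (R := k)) LinearMap.id F) :=
      map_mul (Algebra.TensorProduct.assoc k k k H H H) _ _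
    rw [Fseq_add_two k H F m ih, hcoc, e, map_mul (tA k H m), tA_assoc, tA_assoc, cons_map_map,
      ← mul_assoc, ← snocE_cons, ← map_mul (snocE k H (m + 1))]
    congr 2
    rw [TensorProduct.map_tmul, Algebra.TensorProduct.tmul_mul_tmul, Fseq_succ]
    simp

/-- `g₁ ⊗ ⋯ ⊗ g_{2n+2} ↦ g₁ S(g_{2n+2}) ⊗ ⋯ ⊗ g_{n+1} S(g_{n+2})`. -/
noncomputable def phi : ∀ n : ℕ, Tpow k H (2 * n + 1) →ₗ[k] Tpow k H n
  | 0 => show Tpow k H 1 →ₗ[k] H from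
      LinearMap.mul' k H ∘ₗ TensorProduct.map LinearMap.id (HopfAlgebra.antipode k) ∘ₗ
        (consE k H 0).symm.toLinearMap
  | n + 1 => show Tpow k H (2 * n + 3) →ₗ[k] Tpow k H (n + 1) from
      (consE k H n).toLinearMap ∘ₗ
      TensorProduct.map (LinearMap.mul' k H ∘ₗ
        TensorProduct.map LinearMap.id (HopfAlgebra.antipode k)) (phi n) ∘ₗ
      (TensorProduct.assoc k H H _).symm.toLinearMap ∘ₗ
      TensorProduct.map LinearMap.id
        ((TensorProduct.comm k _ H).toLinearMap ∘ₗ (snocE k H (2 * n + 1)).symm.toLinearMap) ∘ₗ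
      (consE k H (2 * n + 2)).symm.toLinearMap

lemma phi_zero (a b : H) : phi k H 0 (consE k H 0 (a ⊗ₜ[k] (b : H))) =
    (a * HopfAlgebra.antipode k b : H) := rfl

lemma phi_succ (n : ℕ) (g c : H) (t : Tpow k H (2 * n + 1)) :
    phi k H (n + 1) (consE k H (2 * n + 2) (g ⊗ₜ snocE k H (2 * n + 1) (t ⊗ₜ c))) =
      consE k H n ((g * HopfAlgebra.antipode k c) ⊗ₜ phi k H n t) := by
  simp [phi]

/-- `a ⊗ b ⊗ d ↦ a ε(b) S(d)`. -/
noncomputable def mM : (H ⊗[k] (H ⊗[k] H)) →ₗ[k] H :=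
  LinearMap.mul' k H ∘ₗ TensorProduct.map LinearMap.id (HopfAlgebra.antipode k) ∘ₗ
    TensorProduct.map LinearMap.id ((TensorProduct.lid k H).toLinearMap ∘ₗ
      TensorProduct.map (counit (R := k)) LinearMap.id)

lemma mM_tmul (a b d : H) : mM k H (a ⊗ₜ (b ⊗ₜ d)) =
    counit (R := k) b • (a * HopfAlgebra.antipode k d) := by
  simp [mM]

lemma mM_comul (y : H ⊗[k] H) :
    mM k H (TensorProduct.map LinearMap.id (comul (R := k)) y) =
      LinearMap.mul' k H (TensorProduct.map LinearMap.id (HopfAlgebra.antipode k) y) := by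
  induction y with
  | zero => simp
  | add a b ha hb => simp only [map_add, ha, hb]
  | tmul a b =>
    have : TensorProduct.map (counit (R := k)) LinearMap.id (comul (R := k) b) = 1 ⊗ₜ[k] b :=
      Coalgebra.rTensor_counit_comul b
    simp [mM, this]

lemma phi_mul_tA (n : ℕ)
    (h : ∀ (G : Tpow k H (2 * n + 1)) (x : H),
      phi k H n (G * cA k H (2 * n + 1) x) = counit (R := k) x • phi k H n G)
    (g c : H) (t : Tpow k H (2 * n + 1)) (y : H ⊗[k] (H ⊗[k] H)) :
    phi k H (n + 1) (consE k H (2 * n + 2) (g ⊗ₜ snocE k H (2 * n + 1) (t ⊗ₜ c)) *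
      tA k H (2 * n + 1) y) =
    consE k H n ((g * mM k H y * HopfAlgebra.antipode k c) ⊗ₜ phi k H n t) := by
  induction y with
  | zero => simp
  | add a b ha hb =>
    simp only [map_add, mul_add, add_mul, TensorProduct.add_tmul] at ha hb ⊢
    rw [ha, hb]
  | tmul a z =>
    induction z with
    | zero => simp
    | add a b ha hb =>
      simp only [map_add, mul_add, add_mul, TensorProduct.tmul_add, TensorProduct.add_tmul]
        at ha hb ⊢
      rw [ha, hb]
    | tmul b d =>
      rw [tA_tmul, ← map_mul (consE k H (2 * n + 2)), Algebra.TensorProduct.tmul_mul_tmul,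
        ← map_mul (snocE k H (2 * n + 1)), Algebra.TensorProduct.tmul_mul_tmul, phi_succ, h,
        mM_tmul, HopfAlgebra.antipode_mul_antidistrib]
      simp [TensorProduct.smul_tmul', TensorProduct.tmul_smul, mul_assoc]

lemma mul_zero_aux (g c : H) (y : H ⊗[k] H) :
    LinearMap.mul' k H (TensorProduct.map LinearMap.id (HopfAlgebra.antipode k)
      ((g ⊗ₜ[k] c) * y)) =
    g * LinearMap.mul' k H (TensorProduct.map LinearMap.id (HopfAlgebra.antipode k) y) *
      HopfAlgebra.antipode k c := by
  induction y with
  | zero => simp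
  | add a b ha hb => simp only [map_add, mul_add, add_mul, ha, hb]
  | tmul a b => simp [HopfAlgebra.antipode_mul_antidistrib, mul_assoc]

lemma phi_collapse (n : ℕ) (G : Tpow k H (2 * n + 1)) (x : H) :
    phi k H n (G * cA k H (2 * n + 1) x) = counit (R := k) x • phi k H n G := by
  induction n generalizing x with
  | zero =>
    obtain ⟨y, rfl⟩ := (consE k H 0).surjective G
    induction y with
    | zero => simp
    | add a b ha hb =>
      simp only [map_add, add_mul, smul_add] at ha hb ⊢
      rw [ha, hb]
    | tmul g c =>
      have e0 : cA k H (2 * 0 + 1) x = consE k H 0 (comul (R := k) x) :=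
        congrArg (consE k H 0) (LinearMap.congr_fun TensorProduct.map_id (comul (R := k) x))
      have e2 : LinearMap.mul' k H
            (TensorProduct.map LinearMap.id (HopfAlgebra.antipode k) (comul (R := k) x)) =
            algebraMap k H (counit (R := k) x) :=
        HopfAlgebra.mul_antipode_lTensor_comul_apply x
      have e := mul_zero_aux k H g c (comul (R := k) x)
      rw [e2, ← Algebra.commutes, mul_assoc, ← Algebra.smul_def] at e
      rw [e0]
      exact e
  | succ n ih =>
    obtain ⟨y, rfl⟩ := (consE k H (2 * n + 2)).surjective G
    induction y with
    | zero => simp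
    | add a b ha hb =>
      simp only [map_add, add_mul, smul_add] at ha hb ⊢
      rw [ha, hb]
    | tmul g t =>
      obtain ⟨z, rfl⟩ := (snocE k H (2 * n + 1)).surjective t
      induction z with
      | zero => simp
      | add a b ha hb =>
        simp only [map_add, add_mul, smul_add, TensorProduct.tmul_add] at ha hb ⊢
        rw [ha, hb]
      | tmul t c =>
        have e : cA k H (2 * (n + 1) + 1) x = tA k H (2 * n + 1)
            (TensorProduct.map LinearMap.id (comul (R := k)) (comul (R := k) x)) := by
          rw [← map_cA]; rfl
        rw [e]
        refine (phi_mul_tA k H n ih g c t _).trans ?_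
        have e2 : LinearMap.mul' k H
            (TensorProduct.map LinearMap.id (HopfAlgebra.antipode k) (comul (R := k) x)) =
            algebraMap k H (counit (R := k) x) :=
          HopfAlgebra.mul_antipode_lTensor_comul_apply x
        rw [mM_comul, e2, ← Algebra.commutes, mul_assoc, ← Algebra.smul_def, phi_succ,
          ← TensorProduct.smul_tmul', map_smul]

lemma mM_F3 (F : H ⊗[k] H)
    (hcu₁ : (TensorProduct.lid k H)
      ((TensorProduct.map (Coalgebra.counit (R := k)) LinearMap.id) F) = 1) :
    mM k H (F3 k H F) =
      LinearMap.mul' k H (TensorProduct.map LinearMap.id (HopfAlgebra.antipode k) F) := by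
  let E : (H ⊗[k] H) →ₐ[k] H := (Algebra.TensorProduct.lid k H).toAlgHom.comp
    (Algebra.TensorProduct.map (Bialgebra.counitAlgHom k H) (AlgHom.id k H))
  let W : (H ⊗[k] (H ⊗[k] H)) →ₐ[k] (H ⊗[k] H) := Algebra.TensorProduct.map (AlgHom.id k H) E
  have hM : ∀ y, mM k H y =
      LinearMap.mul' k H (TensorProduct.map LinearMap.id (HopfAlgebra.antipode k) (W y)) :=
    fun y => rfl
  have h1 : W (1 ⊗ₜ F) = 1 := by
    have : W (1 ⊗ₜ F) = 1 ⊗ₜ ((TensorProduct.lid k H)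
      ((TensorProduct.map (Coalgebra.counit (R := k)) LinearMap.id) F)) := rfl
    rw [this, hcu₁]; rfl
  rw [F3, hM, map_mul, h1, one_mul, ← hM, mM_comul]

lemma phi_Fseq (F : H ⊗[k] H)
    (hcu₁ : (TensorProduct.lid k H)
      ((TensorProduct.map (Coalgebra.counit (R := k)) LinearMap.id) F) = 1)
    (hcoc : F3 k H F =
      (TensorProduct.assoc k H H H)
        ((F ⊗ₜ[k] (1 : H)) *
          (TensorProduct.map (Coalgebra.comul (R := k)) LinearMap.id F))) (n : ℕ) :
    phi k H n (Fseq k H F (2 * n + 1)) = nest k H n (fun _ =>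
      LinearMap.mul' k H (TensorProduct.map LinearMap.id (HopfAlgebra.antipode k) F)) := by
  induction n with
  | zero =>
    have : Fseq k H F 1 = consE k H 0 F := by
      have e1 : consE k H 0 ((1 : H) ⊗ₜ[k] Fseq k H F 0) = 1 := map_one (consE k H 0)
      have e2 : (TensorProduct.map LinearMap.id (cA k H 0).toLinearMap F) = F :=
        LinearMap.congr_fun TensorProduct.map_id F
      rw [Fseq_succ, e1, one_mul, e2]
    change phi k H 0 (Fseq k H F 1) = _
    rw [this]; rfl
  | succ n ih =>
    change phi k H (n + 1) (Fseq k H F (2 * n + 1 + 2)) = _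
    rw [Fseq_add_two k H F _ (Fseq_snoc k H F hcoc _)]
    refine (phi_mul_tA k H n (phi_collapse k H n) _ _ _ _).trans ?_
    rw [mM_F3 k H F hcu₁, HopfAlgebra.antipode_one, one_mul, mul_one, ih]
    rfl

lemma nest_succ (n : ℕ) (f : Fin (n + 2) → H) : nest k H (n + 1) f =
    consE k H n (f 0 ⊗ₜ nest k H n (fun i => f i.succ)) := rfl

lemma nest_snoc (n : ℕ) (f : Fin (n + 2) → H) : nest k H (n + 1) f =
    snocE k H n (nest k H n (fun i => f i.castSucc) ⊗ₜ f (Fin.last _)) := by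
  induction n with
  | zero => rfl
  | succ n ih =>
    rw [nest_succ, ih, nest_succ, snocE_cons]; rfl

lemma phi_nest (n : ℕ) (f : Fin (2 * n + 2) → H) : phi k H n (nest k H (2 * n + 1) f) =
    nest k H n (fun t => f ⟨t, by omega⟩ *
      HopfAlgebra.antipode k (f ⟨2 * n + 1 - t, by omega⟩)) := by
  induction n with
  | zero => rfl
  | succ n ih =>
    change phi k H (n + 1) (nest k H (2 * n + 1 + 1 + 1) f) = _
    rw [nest_succ, nest_snoc]
    refine (phi_succ k H n _ _ _).trans ?_
    rw [ih, nest_succ]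
    congr 3
    funext t
    congr 3
    apply Fin.ext
    simp
    omega

end helpers

theorem statement8
    (k H : Type) [Field k] [Ring H] [HopfAlgebra k H] [FiniteDimensional k H]
    (S : H →ₗ[k] H) (hS : S = HopfAlgebra.antipode (R := k))
    (F F' : H ⊗[k] H)
    (hinv₁ : F * F' = 1) (hinv₂ : F' * F = 1)
    (hcu₁ : (TensorProduct.lid k H)
      ((TensorProduct.map (Coalgebra.counit (R := k)) LinearMap.id) F) = 1)
    (hcu₂ : (TensorProduct.rid k H)
      ((TensorProduct.map LinearMap.id (Coalgebra.counit (R := k))) F) = 1)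
    (hcoc : ((1 : H) ⊗ₜ[k] F) *
        (TensorProduct.map LinearMap.id (Coalgebra.comul (R := k)) F) =
      (TensorProduct.assoc k H H H)
        ((F ⊗ₜ[k] (1 : H)) *
          (TensorProduct.map (Coalgebra.comul (R := k)) LinearMap.id F)))
    -- the Drinfeld element u = f⁽¹⁾S(f⁽²⁾):
    (u : H) (hu : u = LinearMap.mul' k H ((TensorProduct.map LinearMap.id S) F))
    (n : ℕ) (hn : 1 ≤ n)
    -- a finite-sum representation of F_{2n+1} by pure tensors:
    (m : ℕ) (f : Fin m → Fin (2 * n + 1) → H)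
    (hrep : Fseq k H F (2 * n) = ∑ i, nest k H (2 * n) (f i)) :
    nest k H n (fun t => if (t : ℕ) = 0 then 1 else u) =
      ∑ i, nest k H n (fun t =>
        if ht : (t : ℕ) = 0 then f i ⟨0, by omega⟩
        else
          f i ⟨(t : ℕ), by have := t.isLt; omega⟩ *
            S (f i ⟨2 * n + 1 - (t : ℕ), by have := t.isLt; omega⟩)) := by
  subst hS
  obtain ⟨n, rfl⟩ : ∃ n', n = n' + 1 := ⟨n - 1, by omega⟩
  let Psi : Tpow k H (2 * n + 2) →ₗ[k] Tpow k H (n + 1) :=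
    (consE k H n).toLinearMap ∘ₗ TensorProduct.map LinearMap.id (phi k H n) ∘ₗ
      (consE k H (2 * n + 1)).symm.toLinearMap
  have hPsi : ∀ (a : H) (t : Tpow k H (2 * n + 1)),
      Psi (consE k H (2 * n + 1) (a ⊗ₜ t)) = consE k H n (a ⊗ₜ phi k H n t) := by
    intro a t; simp [Psi]
  have h1 : Psi (Fseq k H F (2 * n + 1 + 1)) = consE k H n (1 ⊗ₜ nest k H n (fun _ => u)) := by
    rw [Fseq_succ]
    have key : ∀ y : H ⊗[k] H, Psi (consE k H (2 * n + 1) (1 ⊗ₜ Fseq k H F (2 * n + 1)) *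
        consE k H (2 * n + 1) (TensorProduct.map LinearMap.id
          (cA k H (2 * n + 1)).toLinearMap y)) =
        consE k H n ((TensorProduct.rid k H
          ((TensorProduct.map LinearMap.id (Coalgebra.counit (R := k))) y)) ⊗ₜ
            phi k H n (Fseq k H F (2 * n + 1))) := by
      intro y
      induction y with
      | zero => simp
      | add a b ha hb =>
        simp only [map_add, mul_add, TensorProduct.add_tmul] at ha hb ⊢
        rw [ha, hb]
      | tmul a b =>
        rw [← map_mul (consE k H (2 * n + 1)), TensorProduct.map_tmul,
          Algebra.TensorProduct.tmul_mul_tmul, hPsi, AlgHom.toLinearMap_apply, phi_collapse]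
        simp [TensorProduct.smul_tmul']
    rw [key, hcu₂, phi_Fseq k H F hcu₁ hcoc, hu]
  have h2 : Fseq k H F (2 * n + 1 + 1) = ∑ i, nest k H (2 * n + 1 + 1) (f i) := hrep
  have h3 : nest k H (n + 1) (fun t => if (t : ℕ) = 0 then 1 else u) =
      consE k H n (1 ⊗ₜ nest k H n (fun _ => u)) := by
    rw [nest_succ]; simp
  rw [h3, ← h1, h2, map_sum]
  refine Finset.sum_congr rfl fun i _ => ?_
  rw [nest_succ, hPsi, phi_nest, nest_succ]
  congr 3
  funext t
  have : ((t.succ : Fin (n + 2)) : ℕ) ≠ 0 := by simp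
  rw [dif_neg this]
  congr 3
  apply Fin.ext
  simp
  omega
end
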